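/- arXiv:2405.17194 — 8 statements merged into one kernel-verified Lean document; each statement's English description precedes it below -/
import Mathlib

section
/- Let Q be a polynomial with integer coefficients such that Q(n) is the square of an integer for all but finitely many positive integers n. Then Q is the square of a polynomial with integer coefficients, i.e. there exists R ∈ ℤ[t] with Q = R². -/
open Polynomial Filter

theorem UniqueFactorizationMonoid.exists_squarefree_mul_sq {M : Type*} [CommMonoidWithZero M]
    [UniqueFactorizationMonoid M] {x : M} (hx : x ≠ 0) :
    ∃ a b : M, Squarefree a ∧ x = a * b ^ 2 := by
  induction x using WfDvdMonoid.induction_on_irreducible with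
  | zero => contradiction
  | unit u hu => exact ⟨u, 1, hu.squarefree, by simp⟩
  | mul z p hz hp ih =>
    obtain ⟨a, b, ha, rfl⟩ := ih hz
    by_cases hpa : p ∣ a
    · obtain ⟨c, rfl⟩ := hpa
      refine ⟨c, p * b, ha.of_mul_right, ?_⟩
      rw [mul_pow, sq p]
      ac_rfl
    · exact ⟨p * a, b, squarefree_mul_iff.mpr
        ⟨hp.isRelPrime_iff_not_dvd.mpr hpa, hp.squarefree, ha⟩, (mul_assoc _ _ _).symm⟩

theorem Polynomial.exists_int_map_eq_C_mul (f : ℚ[X]) :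
    ∃ d : ℤ, d ≠ 0 ∧ ∃ g : ℤ[X], g.map (Int.castRingHom ℚ) = C (d : ℚ) * f := by
  obtain ⟨d, hd, h⟩ := IsLocalization.integerNormalization_spec (nonZeroDivisors ℤ) f
  refine ⟨d, nonZeroDivisors.ne_zero hd, IsLocalization.integerNormalization (nonZeroDivisors ℤ) f, ?_⟩
  rw [← algebraMap_int_eq, h, ← smul_eq_C_mul, Int.cast_smul_eq_zsmul]

theorem Polynomial.eventually_eval_natCast_ne_zero {P : ℤ[X]} (hP : P ≠ 0) :
    ∀ᶠ n : ℕ in atTop, P.eval (n : ℤ) ≠ 0 := by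
  rw [← Nat.cofinite_eq_atTop]
  have h := (P.finite_setOfPred_isRoot hP).preimage
    (f := fun n : ℕ => (n : ℤ)) Nat.cast_injective.injOn
  filter_upwards [h.compl_mem_cofinite] with n hn using hn

/-- The values of a nonconstant integer polynomial have prime factors coprime to any given
nonzero integer. -/
theorem Polynomial.exists_prime_dvd_eval_not_dvd {P : ℤ[X]} (hP : 0 < P.natDegree) {d : ℤ}
    (hd : d ≠ 0) (N : ℕ) :
    ∃ p : ℕ, p.Prime ∧ ¬ (p : ℤ) ∣ d ∧ ∃ n ≥ N, (p : ℤ) ∣ P.eval (n : ℤ) := by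
  have hP0 : P ≠ 0 := ne_zero_of_natDegree_gt hP
  obtain ⟨n₀, he, hn₀⟩ :=
    ((eventually_eval_natCast_ne_zero hP0).and (eventually_ge_atTop N)).exists
  set e := P.eval (n₀ : ℤ)
  have hW : P ^ 2 - C (e ^ 2) ≠ 0 := by
    intro h
    have := congrArg natDegree (sub_eq_zero.mp h)
    rw [natDegree_pow, natDegree_C] at this
    omega
  have hM : 0 < (d * e).natAbs := Int.natAbs_pos.mpr (mul_ne_zero hd he)
  have ht : Tendsto (fun k : ℕ => n₀ + (d * e).natAbs * k) atTop atTop :=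
    tendsto_atTop_mono (fun k => le_add_left (Nat.le_mul_of_pos_left k hM)) tendsto_id
  obtain ⟨k, hk⟩ := (ht.eventually (eventually_eval_natCast_ne_zero hW)).exists
  set n := n₀ + (d * e).natAbs * k with hn
  have hdvd : d * e ∣ P.eval (n : ℤ) - e := by
    refine dvd_trans ?_ (sub_dvd_eval_sub (n : ℤ) n₀ P)
    rw [hn]
    push_cast
    rw [add_sub_cancel_left]
    exact ((dvd_abs _ _).mpr dvd_rfl).mul_right _
  obtain ⟨t, ht⟩ := hdvd
  have hval : P.eval (n : ℤ) = e * (1 + d * t) := by linear_combination ht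
  have h1 : (1 + d * t).natAbs ≠ 1 := by
    intro h
    apply hk
    rw [eval_sub, eval_pow, eval_C, hval, mul_pow, ← Int.natAbs_sq (1 + d * t), h]
    simp
  obtain ⟨p, hp, hpd⟩ := Nat.exists_prime_and_dvd h1
  have hpd' : (p : ℤ) ∣ 1 + d * t := Int.natCast_dvd.mpr hpd
  refine ⟨p, hp, fun h => ?_, n, by omega, hval ▸ hpd'.mul_left e⟩
  exact (Nat.prime_iff_prime_int.mp hp).not_dvd_one
    ((Int.dvd_add_left (h.mul_right t)).mp hpd')

theorem Polynomial.natDegree_eq_zero_of_separable_of_eventually_isSquare {P : ℤ[X]}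
    (hsep : (P.map (Int.castRingHom ℚ)).Separable)
    (hsq : ∀ᶠ n : ℕ in atTop, ∃ m : ℤ, P.eval (n : ℤ) = m ^ 2) : P.natDegree = 0 := by
  by_contra hdeg
  obtain ⟨u, v, huv⟩ := hsep
  obtain ⟨a, ha, U, hU⟩ := exists_int_map_eq_C_mul u
  obtain ⟨b, hb, V, hV⟩ := exists_int_map_eq_C_mul v
  have hbez : C b * U * P + C a * V * derivative P = C (a * b) := by
    apply map_injective (Int.castRingHom ℚ) Int.cast_injective
    rw [derivative_map] at huv
    simp only [Polynomial.map_add, Polynomial.map_mul, hU, hV, eq_intCast, map_intCast,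
      Polynomial.map_intCast, map_mul]
    linear_combination (a : ℚ[X]) * (b : ℚ[X]) * huv
  obtain ⟨N, hN⟩ := eventually_atTop.mp hsq
  obtain ⟨p, hp, hpd, n, hn, hpn⟩ :=
    exists_prime_dvd_eval_not_dvd (Nat.pos_of_ne_zero hdeg) (mul_ne_zero ha hb) N
  have hp' := Nat.prime_iff_prime_int.mp hp
  obtain ⟨x, hx⟩ := hN n hn
  obtain ⟨y, hy⟩ := hN (n + p) (by omega)
  obtain ⟨k, hk⟩ := binomExpansion P (n : ℤ) p
  push_cast at hy
  have hpx : (p : ℤ) ^ 2 ∣ P.eval (n : ℤ) := by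
    rw [hx] at hpn ⊢
    exact pow_dvd_pow_of_dvd (hp'.dvd_of_dvd_pow hpn) 2
  have hpy : (p : ℤ) ^ 2 ∣ P.eval ((n : ℤ) + p) := by
    have h : (p : ℤ) ∣ P.eval ((n : ℤ) + p) := by
      rw [hk]
      exact (hpn.add (dvd_mul_left _ _)).add ((dvd_pow_self _ two_ne_zero).mul_left _)
    rw [hy] at h ⊢
    exact pow_dvd_pow_of_dvd (hp'.dvd_of_dvd_pow h) 2
  have hder : (p : ℤ) ∣ P.derivative.eval (n : ℤ) := by
    have h : (p : ℤ) * p ∣ P.derivative.eval (n : ℤ) * p := by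
      obtain ⟨c, hc⟩ := (hpy.sub hpx).sub (dvd_mul_left ((p : ℤ) ^ 2) k)
      exact ⟨c, by linear_combination hc - hk⟩
    exact (mul_dvd_mul_iff_right hp'.ne_zero).mp h
  apply hpd
  have := congrArg (eval (n : ℤ)) hbez
  rw [eval_C] at this
  rw [← this, eval_add, eval_mul, eval_mul (p := C a * V)]
  exact (hpn.mul_left _).add (hder.mul_left _)

theorem Polynomial.exists_C_sq_mul_eq_mul_sq {Q : ℤ[X]} (hQ : Q ≠ 0) :
    ∃ d : ℤ, d ≠ 0 ∧ ∃ A B : ℤ[X], (A.map (Int.castRingHom ℚ)).Separable ∧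
      C d ^ 2 * Q = A * B ^ 2 := by
  have hinj := map_injective (Int.castRingHom ℚ) Int.cast_injective
  have hQ' : Q.map (Int.castRingHom ℚ) ≠ 0 := fun h => hQ (hinj (by simpa using h))
  obtain ⟨a, b, ha, hab⟩ := UniqueFactorizationMonoid.exists_squarefree_mul_sq hQ'
  obtain ⟨r, hr, A, hA⟩ := exists_int_map_eq_C_mul a
  obtain ⟨s, hs, B, hB⟩ := exists_int_map_eq_C_mul b
  refine ⟨r * s, mul_ne_zero hr hs, C r * A, B, ?_, hinj ?_⟩
  · have hu : IsUnit (C ((r : ℚ) * r)) := by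
      rw [isUnit_C]
      exact (mul_ne_zero (Int.cast_ne_zero.mpr hr) (Int.cast_ne_zero.mpr hr)).isUnit
    rw [Polynomial.map_mul, map_C, hA, eq_intCast, ← mul_assoc, ← C_mul]
    exact Separable.unit_mul hu (PerfectField.separable_iff_squarefree.mpr ha)
  · simp only [Polynomial.map_mul, Polynomial.map_pow, hA, hB, hab, eq_intCast,
      map_intCast, Polynomial.map_intCast, map_mul]
    ring

theorem square_values_imply_square_polynomial
    (Q : Polynomial ℤ)
    (hQ : ∀ᶠ (n : ℕ) in Filter.atTop, ∃ m : ℤ, Q.eval (n : ℤ) = m ^ 2) :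
    ∃ R : Polynomial ℤ, Q = R ^ 2 := by
  rcases eq_or_ne Q 0 with rfl | hQ0
  · exact ⟨0, by simp⟩
  obtain ⟨d, hd, A, B, hA, hAB⟩ := exists_C_sq_mul_eq_mul_sq hQ0
  have hCd : C d ≠ 0 := C_ne_zero.mpr hd
  have hB : B ≠ 0 := by
    rintro rfl
    exact mul_ne_zero (pow_ne_zero 2 hCd) hQ0 (by simpa using hAB)
  have hAsq : ∀ᶠ n : ℕ in atTop, ∃ m : ℤ, A.eval (n : ℤ) = m ^ 2 := by
    filter_upwards [hQ, eventually_eval_natCast_ne_zero hB] with n ⟨m, hm⟩ hBn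
    have h := congrArg (eval (n : ℤ)) hAB
    simp only [eval_mul, eval_pow, eval_C, hm] at h
    have hdvd : B.eval (n : ℤ) ^ 2 ∣ (d * m) ^ 2 := ⟨A.eval (n : ℤ), by linear_combination h⟩
    obtain ⟨c, hc⟩ := (Int.pow_dvd_pow_iff two_ne_zero).mp hdvd
    refine ⟨c, mul_right_cancel₀ (pow_ne_zero 2 hBn) ?_⟩
    rw [← h, ← mul_pow, hc]
    ring
  obtain ⟨a, rfl⟩ := natDegree_eq_zero.mp
    (natDegree_eq_zero_of_separable_of_eventually_isSquare hA hAsq)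
  obtain ⟨n, m, hm⟩ := hAsq.exists
  rw [eval_C] at hm
  have hQeq : C d ^ 2 * Q = (C m * B) ^ 2 := by rw [hAB, hm, C_pow, mul_pow]
  obtain ⟨R, hR⟩ := (IsIntegrallyClosed.pow_dvd_pow_iff two_ne_zero).mp ⟨Q, hQeq.symm⟩
  refine ⟨R, mul_left_cancel₀ (pow_ne_zero 2 hCd) ?_⟩
  rw [hQeq, hR, mul_pow]
end

section
/- Let x be a nonzero complex number that is integral over ℤ (i.e. a nonzero algebraic integer). Then there exists a positive integer n such that (n·x)² − x is not the square of any element of the field ℚ(x), where ℚ(x) denotes the subfield of ℂ generated by x over ℚ. -/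
open Polynomial in
/-- A nonconstant integer polynomial with nonzero constant term has a root modulo some prime
not dividing a given nonzero integer. -/
theorem Polynomial.exists_prime_dvd_eval (f : ℤ[X]) (hdeg : 0 < f.natDegree)
    (h0 : f.eval 0 ≠ 0) (k : ℤ) (hk : k ≠ 0) :
    ∃ (p : ℕ) (m : ℤ), p.Prime ∧ ¬ (p : ℤ) ∣ k ∧ (p : ℤ) ∣ f.eval m := by
  obtain ⟨t, ht⟩ : ∃ t : ℤ, (f.eval (f.eval 0 * k * t)) ^ 2 ≠ (f.eval 0) ^ 2 := by
    by_contra! h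
    have hinf : Set.Infinite {y : ℤ | (f ^ 2).eval y = (C (f.eval 0 ^ 2)).eval y} := by
      refine (Set.infinite_range_of_injective
        (mul_right_injective₀ (mul_ne_zero h0 hk))).mono ?_
      rintro _ ⟨t, rfl⟩
      simpa using h t
    have := congrArg natDegree (eq_of_infinite_eval_eq _ _ hinf)
    rw [natDegree_pow, natDegree_C] at this
    omega
  obtain ⟨w, hw⟩ := sub_dvd_eval_sub (f.eval 0 * k * t) 0 f
  have hfac : f.eval (f.eval 0 * k * t) = f.eval 0 * (1 + k * t * w) := by
    linear_combination hw
  have hne : (1 + k * t * w).natAbs ≠ 1 := by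
    intro h
    apply ht
    rw [hfac, mul_pow, Int.natAbs_eq_iff_sq_eq.mp (h.trans Int.natAbs_one.symm)]
    ring
  obtain ⟨p, hp, hpd⟩ := Nat.exists_prime_and_dvd hne
  have hpd' : (p : ℤ) ∣ 1 + k * t * w := Int.natCast_dvd.mpr hpd
  refine ⟨p, _, hp, fun hpk => ?_, hfac ▸ hpd'.mul_left _⟩
  have h1 : (p : ℤ) ∣ 1 :=
    (dvd_add_left ((hpk.mul_right t).mul_right w)).mp hpd'
  exact (Nat.prime_iff_prime_int.mp hp).not_dvd_one h1

/-- In `ZMod p` with `p` an odd prime, the set of squares is not stable under translation by a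
nonzero element. -/
theorem ZMod.exists_not_isSquare_sq_sub (p : ℕ) [Fact p.Prime] (hp : p ≠ 2) (b : ZMod p)
    (hb : b ≠ 0) : ∃ y : ZMod p, ¬ IsSquare (y ^ 2 - b) := by
  by_contra! h
  have hmul : ∀ j : ℕ, IsSquare (-(j : ZMod p) * b) := by
    intro j
    induction j with
    | zero => simp
    | succ j ih =>
      obtain ⟨y, hy⟩ := ih
      convert h y using 1
      push_cast
      linear_combination hy
  obtain ⟨z, hz⟩ := FiniteField.exists_nonsquare (F := ZMod p) (by rwa [ZMod.ringChar_zmod_n])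
  apply hz
  convert hmul (-z * b⁻¹).val using 1
  rw [ZMod.natCast_zmod_val]
  field_simp

/-- The integral elements of a number field with an integral primitive element
have a common denominator over the subring generated by that element. -/
theorem PowerBasis.exists_common_denominator {K : Type*} [Field K] [Algebra ℚ K]
    (B : PowerBasis ℚ K) (hB : IsIntegral ℤ B.gen) :
    ∃ D : ℤ, D ≠ 0 ∧ ∀ z : K, IsIntegral ℤ z → (D : K) * z ∈ Algebra.adjoin ℤ {B.gen} := by
  have : FiniteDimensional ℚ K := B.finite
  have hdint : IsIntegral ℤ (Algebra.discr ℚ B.basis) :=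
    Algebra.discr_isIntegral ℚ fun i => by
      rw [B.basis_eq_pow]
      exact hB.pow _
  obtain ⟨D, hD⟩ := IsIntegrallyClosed.isIntegral_iff.mp hdint
  refine ⟨D, ?_, fun z hz => ?_⟩
  · rintro rfl
    refine Algebra.discr_not_zero_of_basis ℚ B.basis ?_
    convert hD.symm using 1
    rw [map_zero]
  · convert Algebra.discr_mul_isIntegral_mem_adjoin ℚ hB hz using 1
    rw [Algebra.smul_def]
    congr 1
    trans algebraMap ℚ K (algebraMap ℤ ℚ D)
    · simp
    · rw [hD]

open Polynomial in
/-- The integral elements of `ℚ(x)`, for `x` integral, have a common denominator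
over `ℤ[x]`. -/
theorem exists_common_denominator_adjoin (x : ℂ) (hint : IsIntegral ℤ x) :
    ∃ D : ℤ, D ≠ 0 ∧ ∀ s ∈ IntermediateField.adjoin ℚ {x}, IsIntegral ℤ s →
      ∃ g : ℤ[X], aeval x g = D * s := by
  let K := IntermediateField.adjoin ℚ {x}
  let B := IntermediateField.adjoin.powerBasis (K := ℚ) (x := x) hint.tower_top
  have hgen : algebraMap K ℂ B.gen = x := by
    simp [B, K, IntermediateField.adjoin.powerBasis_gen]
  have hinj : Function.Injective (algebraMap K ℂ) := (algebraMap K ℂ).injective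
  obtain ⟨D, hD0, hD⟩ := B.exists_common_denominator
    ((isIntegral_algebraMap_iff hinj).mp (by rwa [hgen]))
  refine ⟨D, hD0, fun s hs hsint => ?_⟩
  have hmem := hD ⟨s, hs⟩ ((isIntegral_algebraMap_iff hinj).mp hsint)
  rw [Algebra.adjoin_singleton_eq_range_aeval] at hmem
  obtain ⟨g, hg⟩ := hmem
  refine ⟨g, ?_⟩
  have hg' := congrArg (algebraMap K ℂ) hg
  have hsmap : algebraMap K ℂ ⟨s, hs⟩ = s := rfl
  rwa [AlgHom.toRingHom_eq_coe, RingHom.coe_coe, ← aeval_algebraMap_apply, hgen, map_mul,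
    map_intCast, hsmap] at hg'

theorem exists_n_nonsquare_in_Q_adjoin
    (x : ℂ) (hx : x ≠ 0) (hint : IsIntegral ℤ x) :
    ∃ n : ℕ, 0 < n ∧
      ¬ ∃ s ∈ IntermediateField.adjoin ℚ {x}, s ^ 2 = ((n : ℂ) * x) ^ 2 - x := by
  obtain ⟨D, hD0, hD⟩ := exists_common_denominator_adjoin x hint
  have hc : (minpoly ℤ x).eval 0 ≠ 0 := by
    rw [← Polynomial.coeff_zero_eq_eval_zero]
    have hcQ := minpoly.coeff_zero_ne_zero (hint.tower_top (A := ℚ)) hx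
    rw [minpoly.isIntegrallyClosed_eq_field_fractions' ℚ hint, Polynomial.coeff_map] at hcQ
    exact fun h => hcQ (by rw [h, map_zero])
  obtain ⟨p, m, hp, hpk, hpm⟩ := (minpoly ℤ x).exists_prime_dvd_eval
    (minpoly.natDegree_pos hint) hc (2 * D * (minpoly ℤ x).eval 0)
    (mul_ne_zero (mul_ne_zero two_ne_zero hD0) hc)
  have : Fact p.Prime := ⟨hp⟩
  have hp2 : p ≠ 2 := by
    rintro rfl
    exact hpk (by rw [mul_assoc]; exact dvd_mul_right _ _)
  have hDp : (D : ZMod p) ≠ 0 := by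
    rw [Ne, ZMod.intCast_zmod_eq_zero_iff_dvd]
    exact fun h => hpk ((h.mul_left _).mul_right _)
  have hmp : (m : ZMod p) ≠ 0 := by
    rw [Ne, ZMod.intCast_zmod_eq_zero_iff_dvd]
    intro h
    have hsub : (p : ℤ) ∣ (minpoly ℤ x).eval m - (minpoly ℤ x).eval 0 :=
      h.trans (by simpa using Polynomial.sub_dvd_eval_sub m 0 (minpoly ℤ x))
    exact hpk (((dvd_sub_right hpm).mp hsub).mul_left _)
  obtain ⟨y, hy⟩ := ZMod.exists_not_isSquare_sq_sub p hp2 (m : ZMod p)⁻¹ (inv_ne_zero hmp)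
  refine ⟨y.val + p, by have := hp.pos; omega, ?_⟩
  rintro ⟨s, hs, hsq⟩
  generalize hn : y.val + p = n at hsq
  have hny : (n : ZMod p) = y := by simp [← hn]
  have hsint : IsIntegral ℤ s := by
    refine IsIntegral.of_pow two_pos ?_
    rw [hsq]
    have hnint : IsIntegral ℤ (n : ℂ) := by
      simpa using isIntegral_algebraMap (R := ℤ) (A := ℂ) (x := (n : ℤ))
    exact ((hnint.mul hint).pow 2).sub hint
  obtain ⟨g, hg⟩ := hD s hs hsint
  obtain ⟨q, hq⟩ := minpoly.isIntegrallyClosed_dvd hint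
    (p := g ^ 2 - Polynomial.C (D ^ 2) *
      ((Polynomial.C (n : ℤ) * Polynomial.X) ^ 2 - Polynomial.X)) (by
      simp [hg]
      linear_combination (D : ℂ) ^ 2 * hsq)
  have hev := congrArg (fun r => ((Polynomial.eval m r : ℤ) : ZMod p)) hq
  have hpm' : (((minpoly ℤ x).eval m : ℤ) : ZMod p) = 0 :=
    (ZMod.intCast_zmod_eq_zero_iff_dvd _ _).mpr hpm
  simp only [Polynomial.eval_sub, Polynomial.eval_pow, Polynomial.eval_mul, Polynomial.eval_C,
    Polynomial.eval_X, Int.cast_sub, Int.cast_pow, Int.cast_mul, Int.cast_natCast, hpm',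
    zero_mul, hny] at hev
  refine hy ⟨((g.eval m : ℤ) : ZMod p) / (D * m), ?_⟩
  field_simp
  linear_combination -hev
end

section
/- Let K be a field extension of ℚ that is finite-dimensional over ℚ, and let x ∈ K be such that K = ℚ(x). Let P = a_d t^d + a_{d−1} t^{d−1} + ⋯ + a_1 t + a_0 be the minimal polynomial of x over ℚ, with a_d = 1 and d = [K : ℚ]. Then for every positive integer n, the field norm satisfies N_{K/ℚ}((n·x)² − x) = a_0 · Σ_{k=0}^{d} a_k · n^{2d−2k}. -/
/-- The norm of `c - x` is the value at `c` of the minimal polynomial of a generator `x`. -/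
theorem norm_algebraMap_sub_eq_eval_minpoly {F K : Type*} [Field F] [Field K] [Algebra F K]
    [FiniteDimensional F K] {x : K} (hgen : IntermediateField.adjoin F {x} = ⊤) (c : F) :
    Algebra.norm F (algebraMap F K c - x) = (minpoly F x).eval c := by
  have hx : IsIntegral F x := Algebra.IsIntegral.isIntegral x
  have htop : Algebra.adjoin F {x} = ⊤ := by
    rw [← IntermediateField.adjoin_simple_toSubalgebra_of_isAlgebraic hx.isAlgebraic, hgen,
      IntermediateField.top_toSubalgebra]
  let pb := PowerBasis.ofAdjoinEqTop hx htop
  have hpb : pb.gen = x := PowerBasis.ofAdjoinEqTop_gen hx htop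
  rw [← hpb, ← charpoly_leftMulMatrix pb, Matrix.eval_charpoly,
    Algebra.norm_eq_matrix_det pb.basis, map_sub, AlgHom.commutes]
  rfl

theorem norm_n_mul_sq_sub_self
    (K : Type*) [Field K] [Algebra ℚ K] [FiniteDimensional ℚ K]
    (x : K) (hgen : IntermediateField.adjoin ℚ {x} = ⊤)
    (d : ℕ) (hd : d = Module.finrank ℚ K)
    (hdeg : (minpoly ℚ x).natDegree = d)
    (hmonic : (minpoly ℚ x).coeff d = 1)
    (n : ℕ) (hn : 0 < n) :
    Algebra.norm ℚ (((n : K) * x) ^ 2 - x) =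
      (minpoly ℚ x).coeff 0 * ∑ k ∈ Finset.range (d + 1),
        (minpoly ℚ x).coeff k * (n : ℚ) ^ (2 * d - 2 * k) := by
  have : CharZero K := algebraRat.charZero K
  have hn0 : (n : ℚ) ≠ 0 := by exact_mod_cast hn.ne'
  have hnK : (n : K) ≠ 0 := by exact_mod_cast hn.ne'
  have hfactor : ((n : K) * x) ^ 2 - x =
      (algebraMap ℚ K 0 - x) *
        (algebraMap ℚ K ((n : ℚ) ^ 2) * (algebraMap ℚ K (((n : ℚ) ^ 2)⁻¹) - x)) := by
    simp only [map_zero, map_pow, map_inv₀, map_natCast]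
    field_simp
    ring
  rw [hfactor, map_mul, map_mul, norm_algebraMap_sub_eq_eval_minpoly hgen,
    norm_algebraMap_sub_eq_eval_minpoly hgen, Algebra.norm_algebraMap, ← hd,
    ← Polynomial.coeff_zero_eq_eval_zero, Polynomial.eval_eq_sum_range, hdeg, Finset.mul_sum]
  congr 1
  refine Finset.sum_congr rfl fun k hk => ?_
  have hkd : 2 * k ≤ 2 * d := by have := Finset.mem_range.mp hk; omega
  rw [pow_sub₀ _ hn0 hkd, inv_pow, ← pow_mul, ← pow_mul]
  ring
end

section
/- Let M be a square integer matrix of size m+1 (with m ≥ 1), and let N be the principal submatrix of M obtained by deleting the first row and the first column. Suppose that the characteristic polynomials of M and of N have no common root in ℂ, and that M has a nonzero simple eigenvalue, i.e. some nonzero ρ ∈ ℂ is a root of multiplicity exactly one of the characteristic polynomial of M. Then for every integer p ≥ 1, every nonzero integer c and every integer n ≥ 1, the polynomial χ_M(t^n) − c·y^p·χ_N(t^n) is an irreducible element of (ℤ[y])[t] (equivalently, of the bivariate polynomial ring ℤ[t,y]). -/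
/-- A polynomial in the square of the ideal of polynomials vanishing at `s` has a derivative
vanishing at `s`. -/
theorem aeval_derivative_eq_zero_of_mem_ker_sq {R S : Type*} [CommRing R] [CommRing S]
    [Algebra R S] {s : S} {f : Polynomial R}
    (hf : f ∈ RingHom.ker (Polynomial.aeval (R := R) s) ^ 2) :
    Polynomial.aeval s (Polynomial.derivative f) = 0 := by
  rw [pow_two] at hf
  induction hf using Submodule.mul_induction_on' with
  | mem_mul_mem a ha b hb =>
    rw [RingHom.mem_ker] at ha hb
    simp [Polynomial.derivative_mul, ha, hb]
  | add a _ b _ ha hb => simp [ha, hb]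

/-- A divisor of a monic integer polynomial without complex roots is a unit. -/
theorem isUnit_of_dvd_monic_of_forall_aeval_ne_zero {A r : Polynomial ℤ} (hA : A.Monic)
    (hr : r ∣ A) (hroot : ∀ z : ℂ, Polynomial.aeval z r ≠ 0) : IsUnit r := by
  have hlead : IsUnit r.leadingCoeff := by
    obtain ⟨s, rfl⟩ := hr
    rw [Polynomial.Monic, Polynomial.leadingCoeff_mul] at hA
    exact IsUnit.of_mul_eq_one _ hA
  have hdeg : r.natDegree = 0 := by
    by_contra h
    have hmap : (r.map (Int.castRingHom ℂ)).degree = r.degree :=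
      Polynomial.degree_map_eq_of_injective (RingHom.injective_int _) r
    obtain ⟨z, hz⟩ := Complex.exists_root (f := r.map (Int.castRingHom ℂ))
      (by rw [hmap]; exact Polynomial.natDegree_pos_iff_degree_pos.mp (Nat.pos_of_ne_zero h))
    apply hroot z
    rwa [Polynomial.IsRoot.def, Polynomial.eval_map, ← algebraMap_int_eq,
      ← Polynomial.aeval_def] at hz
  rw [Polynomial.eq_C_of_natDegree_eq_zero hdeg]
  rw [Polynomial.leadingCoeff, hdeg] at hlead
  exact hlead.map Polynomial.C

/-- If `A` is monic and shares no complex root with `B`, and `A` has a simple root, then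
`A - B * Y ^ p` is irreducible. -/
theorem irreducible_C_sub_C_mul_X_pow {A B : Polynomial ℤ} (hA : A.Monic)
    (hcommon : ∀ z : ℂ, Polynomial.aeval z A = 0 → Polynomial.aeval z B ≠ 0) {s : ℂ}
    (hs : Polynomial.aeval s A = 0)
    (hs' : Polynomial.aeval s (Polynomial.derivative A) ≠ 0) {p : ℕ} (hp : p ≠ 0) :
    Irreducible (Polynomial.C A - Polynomial.C B * Polynomial.X ^ p) := by
  set F : Polynomial (Polynomial ℤ) := Polynomial.C A - Polynomial.C B * Polynomial.X ^ p with hF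
  have hB : B ≠ 0 := fun h => hcommon s hs (by simp [h])
  have hdeg : F.natDegree = p := by
    rw [hF, Polynomial.natDegree_sub, Polynomial.natDegree_sub_C,
      Polynomial.natDegree_C_mul_X_pow p B hB]
  have hcoeff0 : F.coeff 0 = A := by simp [hF, Polynomial.coeff_X_pow, hp.symm]
  have hcoeffp : F.coeff p = -B := by simp [hF, Polynomial.coeff_C, hp]
  have hF0 : F ≠ 0 := fun h => hp (by rw [← hdeg, h, Polynomial.natDegree_zero])
  refine Polynomial.irreducible_of_eisenstein_criterion
    (P := RingHom.ker (Polynomial.aeval (R := ℤ) s)) (RingHom.ker_isPrime _) ?_ ?_ ?_ ?_ ?_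
  · rw [Polynomial.leadingCoeff, hdeg, hcoeffp, neg_mem_iff, RingHom.mem_ker]
    exact hcommon s hs
  · intro k hk
    rw [Polynomial.degree_eq_natDegree hF0, hdeg, Nat.cast_lt] at hk
    rcases eq_or_ne k 0 with rfl | hk0
    · rwa [hcoeff0, RingHom.mem_ker]
    · have : F.coeff k = 0 := by
        simp [hF, Polynomial.coeff_C, Polynomial.coeff_X_pow, hk0, hk.ne]
      rw [this]
      exact zero_mem _
  · rw [← Polynomial.natDegree_pos_iff_degree_pos, hdeg]
    exact Nat.pos_of_ne_zero hp
  · rw [hcoeff0]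
    exact fun h => hs' (aeval_derivative_eq_zero_of_mem_ker_sq h)
  · intro r hr
    rw [Polynomial.C_dvd_iff_dvd_coeff] at hr
    have hrA : r ∣ A := hcoeff0 ▸ hr 0
    have hrB : r ∣ B := by simpa [hcoeffp] using hr p
    refine isUnit_of_dvd_monic_of_forall_aeval_ne_zero hA hrA fun z hz => ?_
    exact hcommon z (zero_dvd_iff.mp (hz ▸ map_dvd (Polynomial.aeval z) hrA))
      (zero_dvd_iff.mp (hz ▸ map_dvd (Polynomial.aeval z) hrB))

theorem charpoly_comp_pow_perturbed_irreducible
    (m : ℕ) (hm : 1 ≤ m)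
    (M : Matrix (Fin (m + 1)) (Fin (m + 1)) ℤ)
    (N : Matrix (Fin m) (Fin m) ℤ)
    (hN : N = M.submatrix Fin.succ Fin.succ)
    (hcommon : ¬ ∃ z : ℂ,
      Polynomial.aeval z M.charpoly = 0 ∧ Polynomial.aeval z N.charpoly = 0)
    (hsimple : ∃ ρ : ℂ, ρ ≠ 0 ∧
      Polynomial.rootMultiplicity ρ (M.charpoly.map (Int.castRingHom ℂ)) = 1)
    (p : ℕ) (hp : 1 ≤ p) (c : ℤ) (hc : c ≠ 0) (n : ℕ) (hn : 1 ≤ n) :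
    Irreducible
      ((M.charpoly.comp (Polynomial.X ^ n)).map Polynomial.C -
        Polynomial.C (Polynomial.C c * Polynomial.X ^ p) *
          (N.charpoly.comp (Polynomial.X ^ n)).map Polynomial.C) := by
  obtain ⟨ρ, hρ, hmult⟩ := hsimple
  have hn0 : n ≠ 0 := Nat.one_le_iff_ne_zero.mp hn
  obtain ⟨s, rfl⟩ := IsAlgClosed.exists_pow_nat_eq ρ hn
  have hs0 : s ≠ 0 := fun h => hρ (by rw [h, zero_pow hn0])
  have hmap0 : M.charpoly.map (Int.castRingHom ℂ) ≠ 0 :=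
    (M.charpoly_monic.map _).ne_zero
  have hroot : (M.charpoly.map (Int.castRingHom ℂ)).IsRoot (s ^ n) :=
    (Polynomial.rootMultiplicity_pos hmap0).mp (by rw [hmult]; exact one_pos)
  have hder : Polynomial.aeval (s ^ n) (Polynomial.derivative M.charpoly) ≠ 0 := by
    intro h
    have := (Polynomial.one_lt_rootMultiplicity_iff_isRoot hmap0).mpr ⟨hroot, by
      rwa [Polynomial.derivative_map, Polynomial.IsRoot.def, Polynomial.eval_map,
        ← algebraMap_int_eq, ← Polynomial.aeval_def]⟩
    exact this.ne' hmult
  rw [Polynomial.IsRoot.def, Polynomial.eval_map, ← algebraMap_int_eq,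
    ← Polynomial.aeval_def] at hroot
  have key := irreducible_C_sub_C_mul_X_pow (A := M.charpoly.comp (Polynomial.X ^ n))
    (B := Polynomial.C c * N.charpoly.comp (Polynomial.X ^ n))
    (M.charpoly_monic.comp (Polynomial.monic_X_pow n) (by simpa using hn0))
    (fun z hA hB => hcommon ⟨z ^ n, by simpa [Polynomial.aeval_comp] using hA,
      by simpa [Polynomial.aeval_comp, hc] using hB⟩)
    (s := s) (by simpa [Polynomial.aeval_comp] using hroot)
    (by simp [Polynomial.derivative_comp, Polynomial.derivative_X_pow, Polynomial.aeval_comp, hder, hn0, hs0])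
    (Nat.one_le_iff_ne_zero.mp hp)
  rw [← MulEquiv.irreducible_iff (Polynomial.Bivariate.swap (R := ℤ))] at key
  convert key using 1
  simp only [map_sub, map_mul, map_pow, Polynomial.Bivariate.swap_C, Polynomial.Bivariate.swap_Y,
    Polynomial.map_C]
  ring
end

section
/- For y = 2 and for y = 3, the characteristic polynomial of the 4×4 integer matrix with rows (84+16y, 40+8y, 40, 16), (40+8y, 20+4y, 20, 8), (40, 20, 20, 8), (16, 8, 8, 4) is irreducible in ℚ[t]. -/
open Polynomial

/-- A monic quartic over a domain is irreducible if it has no root and no monic quadratic factor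
`X ^ 2 + a * X + b`. -/
theorem Polynomial.irreducible_quartic_of_no_root_of_no_quadratic_factor
    {R : Type*} [CommRing R] [IsDomain R] (c₃ c₂ c₁ c₀ : R)
    (hroot : ∀ x : R, x ^ 4 + c₃ * x ^ 3 + c₂ * x ^ 2 + c₁ * x + c₀ ≠ 0)
    (hquad : ∀ a b : R, a * (c₂ - b - a * (c₃ - a)) + b * (c₃ - a) = c₁ →
      b * (c₂ - b - a * (c₃ - a)) ≠ c₀) :
    Irreducible (X ^ 4 + C c₃ * X ^ 3 + C c₂ * X ^ 2 + C c₁ * X + C c₀ : R[X]) := by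
  set p : R[X] := X ^ 4 + C c₃ * X ^ 3 + C c₂ * X ^ 2 + C c₁ * X + C c₀ with hp
  have hdeg : p.natDegree = 4 := by rw [hp]; compute_degree!
  have hmonic : p.Monic := by rw [hp]; monicity!
  have hne : p ≠ 1 := fun h => by simp [h] at hdeg
  rw [hmonic.irreducible_iff_natDegree']
  refine ⟨hne, fun f g hf hg hfg hmem => ?_⟩
  have hsum : f.natDegree + g.natDegree = 4 := by rw [← hf.natDegree_mul hg, hfg, hdeg]
  rw [hdeg, Finset.mem_Ioc] at hmem
  obtain hg1 | hg2 : g.natDegree = 1 ∨ g.natDegree = 2 := by omega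
  · have hgX : g = X + C (g.coeff 0) := hg.eq_X_add_C hg1
    apply hroot (-g.coeff 0)
    have h : p.eval (-g.coeff 0) = 0 := by
      rw [← hfg, eval_mul, hgX]
      simp
    simpa [hp] using h
  · have quadratic_eq : ∀ q : R[X], q.Monic → q.natDegree = 2 →
        q = X ^ 2 + C (q.coeff 1) * X + C (q.coeff 0) := fun q hq hq2 => by
      conv_lhs => rw [hq.as_sum, hq2]
      simp [Finset.sum_range_succ]
      ring
    have hprod : C (f.coeff 1 + g.coeff 1 - c₃) * X ^ 3
        + C (f.coeff 0 + g.coeff 0 + f.coeff 1 * g.coeff 1 - c₂) * X ^ 2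
        + C (f.coeff 1 * g.coeff 0 + f.coeff 0 * g.coeff 1 - c₁) * X
        + C (f.coeff 0 * g.coeff 0 - c₀) = 0 := by
      have h := hfg
      rw [quadratic_eq f hf (by omega), quadratic_eq g hg hg2, hp] at h
      simp only [map_add, map_sub, map_mul]
      linear_combination h
    have h3 := congrArg (coeff · 3) hprod
    have h2 := congrArg (coeff · 2) hprod
    have h1 := congrArg (coeff · 1) hprod
    have h0 := congrArg (coeff · 0) hprod
    simp [coeff_X, coeff_C, coeff_X_pow, -map_add, -map_sub, -map_mul] at h3 h2 h1 h0
    have hc : c₃ - f.coeff 1 = g.coeff 1 := by linear_combination -h3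
    have hd : c₂ - f.coeff 0 - f.coeff 1 * g.coeff 1 = g.coeff 0 := by linear_combination -h2
    refine hquad (f.coeff 1) (f.coeff 0) ?_ ?_ <;> rw [hc, hd]
    · linear_combination h1
    · linear_combination h0

/-- A monic integer quartic whose reduction modulo a prime has no root and no monic quadratic
factor is irreducible over `ℚ`. -/
theorem Polynomial.irreducible_map_rat_quartic_of_zmod {p : ℕ} (hp : p.Prime) (c₃ c₂ c₁ c₀ : ℤ)
    (hroot : ∀ x : ZMod p, x ^ 4 + c₃ * x ^ 3 + c₂ * x ^ 2 + c₁ * x + c₀ ≠ 0)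
    (hquad : ∀ a b : ZMod p, a * (c₂ - b - a * (c₃ - a)) + b * (c₃ - a) = c₁ →
      b * (c₂ - b - a * (c₃ - a)) ≠ c₀) :
    Irreducible ((X ^ 4 + C c₃ * X ^ 3 + C c₂ * X ^ 2 + C c₁ * X + C c₀ : ℤ[X]).map
      (Int.castRingHom ℚ)) := by
  have : Fact p.Prime := ⟨hp⟩
  have hmonic : (X ^ 4 + C c₃ * X ^ 3 + C c₂ * X ^ 2 + C c₁ * X + C c₀ : ℤ[X]).Monic := by
    monicity!
  refine (hmonic.irreducible_iff_irreducible_map_fraction_map (K := ℚ)).1 ?_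
  refine hmonic.irreducible_of_irreducible_map (Int.castRingHom (ZMod p)) _ ?_
  simpa using irreducible_quartic_of_no_root_of_no_quadratic_factor
    (c₃ : ZMod p) c₂ c₁ c₀ hroot hquad

theorem genus_two_matrix_charpoly (y : ℤ) :
    (!![84 + 16 * y, 40 + 8 * y, 40, 16;
        40 + 8 * y, 20 + 4 * y, 20, 8;
        40, 20, 20, 8;
        16, 8, 8, 4] : Matrix (Fin 4) (Fin 4) ℤ).charpoly =
      X ^ 4 + C (-128 - 20 * y) * X ^ 3 + C (272 + 496 * y) * X ^ 2
        + C (-128 - 704 * y) * X + C (256 * y) := by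
  simp [Matrix.charpoly, Matrix.charmatrix, Matrix.det_succ_row_zero, Fin.sum_univ_succ,
    Fin.succAbove]
  ring

theorem genus_two_matrix_charpoly_irreducible
    (y : ℤ) (hy : y = 2 ∨ y = 3) :
    Irreducible
      (((!![84 + 16 * y, 40 + 8 * y, 40, 16;
            40 + 8 * y, 20 + 4 * y, 20, 8;
            40, 20, 20, 8;
            16, 8, 8, 4] : Matrix (Fin 4) (Fin 4) ℤ)).charpoly.map
        (Int.castRingHom ℚ)) := by
  rw [genus_two_matrix_charpoly]
  obtain rfl | rfl := hy
  · exact irreducible_map_rat_quartic_of_zmod Nat.prime_three _ _ _ _ (by decide) (by decide)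
  · exact irreducible_map_rat_quartic_of_zmod Nat.prime_eleven _ _ _ _ (by decide) (by decide)
end

section
/- The characteristic polynomial of the 6×6 integer matrix with rows (500, 248, 232, 112, 80, 32), (248, 124, 116, 56, 40, 16), (232, 116, 116, 56, 40, 16), (112, 56, 56, 28, 20, 8), (80, 40, 40, 20, 20, 8), (32, 16, 16, 8, 8, 4) is irreducible in ℚ[t]. -/
set_option maxHeartbeats 1000000 in
open Polynomial in
theorem genus_three_matrix_charpoly :
    (!![500, 248, 232, 112, 80, 32;
        248, 124, 116, 56, 40, 16;
        232, 116, 116, 56, 40, 16;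
        112, 56, 56, 28, 20, 8;
        80, 40, 40, 20, 20, 8;
        32, 16, 16, 8, 8, 4] : Matrix (Fin 6) (Fin 6) ℤ).charpoly =
      X ^ 6 - 792 * X ^ 5 + 14352 * X ^ 4 - 73728 * X ^ 3 + 116736 * X ^ 2 - 73728 * X + 16384 := by
  set A : Matrix (Fin 6) (Fin 6) ℤ := !![500, 248, 232, 112, 80, 32;
    248, 124, 116, 56, 40, 16;
    232, 116, 116, 56, 40, 16;
    112, 56, 56, 28, 20, 8;
    80, 40, 40, 20, 20, 8;
    32, 16, 16, 8, 8, 4] with hA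
  -- Left multiplication by the unimodular matrix `U` makes the characteristic matrix Hessenberg.
  let U : Matrix (Fin 6) (Fin 6) ℤ[X] := !![1, -2, 0, 0, 0, 0;
    0, 1, -1, 0, 0, 0;
    0, 0, 1, -2, 0, 0;
    0, 0, 0, 1, -1, 0;
    0, 0, 0, 0, 1, -2;
    0, 0, 0, 0, 0, 1]
  have hU : U.det = 1 := by
    have hT : U.BlockTriangular id := by
      intro i j hij
      fin_cases i <;> fin_cases j <;> first | rfl | simp at hij
    rw [Matrix.det_of_isUpperTriangular hT]
    simp [U, Fin.prod_univ_succ]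
  have hH : U * A.charmatrix = !![X - 4, -2 * X, 0, 0, 0, 0;
      -16, X - 8, -X, 0, 0, 0;
      -8, -4, X - 4, -2 * X, 0, 0;
      -32, -16, -16, X - 8, -X, 0;
      -16, -8, -8, -4, X - 4, -2 * X;
      -32, -16, -16, -8, -8, X - 4] := by
    ext1 i j
    fin_cases i <;> fin_cases j <;>
      simp [U, hA, Matrix.mul_apply, Fin.sum_univ_succ, Matrix.charmatrix_apply] <;> ring
  rw [Matrix.charpoly, ← one_mul A.charmatrix.det, ← hU, ← Matrix.det_mul, hH]
  simp [Matrix.det_succ_row_zero, Fin.sum_univ_succ, Fin.succAbove]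
  ring

theorem no_linear_factor_mod_seven (a c₀ c₁ c₂ c₃ c₄ : ZMod 7) (h₀ : c₀ * a = 16384)
    (h₁ : c₀ + c₁ * a = -73728) (h₂ : c₁ + c₂ * a = 116736) (h₃ : c₂ + c₃ * a = -73728)
    (h₄ : c₃ + c₄ * a = 14352) (h₅ : c₄ + a = -792) : False := by
  obtain rfl := eq_sub_of_add_eq h₅
  obtain rfl := eq_sub_of_add_eq h₄
  obtain rfl := eq_sub_of_add_eq h₃
  obtain rfl := eq_sub_of_add_eq h₂
  obtain rfl := eq_sub_of_add_eq h₁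
  clear h₁ h₂ h₃ h₄ h₅
  revert a
  decide

theorem no_quadratic_factor_mod_seven (a b c₀ c₁ c₂ c₃ : ZMod 7) (h₀ : c₀ * a = 16384)
    (h₁ : c₀ * b + c₁ * a = -73728) (h₂ : c₀ + (c₁ * b + c₂ * a) = 116736)
    (h₃ : c₁ + (c₂ * b + c₃ * a) = -73728) (h₄ : c₂ + (c₃ * b + a) = 14352)
    (h₅ : c₃ + b = -792) : False := by
  obtain rfl := eq_sub_of_add_eq h₅
  obtain rfl := eq_sub_of_add_eq h₄
  obtain rfl := eq_sub_of_add_eq h₃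
  obtain rfl := eq_sub_of_add_eq h₂
  clear h₂ h₃ h₄ h₅
  revert a b
  decide

theorem no_cubic_factor_mod_five (a b d c₀ c₁ c₂ : ZMod 5) (h₀ : c₀ * a = 16384)
    (h₁ : c₀ * b + c₁ * a = -73728) (h₂ : c₀ * d + (c₁ * b + c₂ * a) = 116736)
    (h₃ : c₀ + (c₁ * d + (c₂ * b + a)) = -73728) (h₄ : c₁ + (c₂ * d + b) = 14352)
    (h₅ : c₂ + d = -792) : False := by
  obtain rfl := eq_sub_of_add_eq h₅
  obtain rfl := eq_sub_of_add_eq h₄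
  obtain rfl := eq_sub_of_add_eq h₃
  clear h₃ h₄ h₅
  revert a b d
  decide

open Polynomial in
theorem genus_three_polynomial_irreducible :
    Irreducible (X ^ 6 - 792 * X ^ 5 + 14352 * X ^ 4 - 73728 * X ^ 3 + 116736 * X ^ 2
      - 73728 * X + 16384 : ℤ[X]) := by
  set P : ℤ[X] := X ^ 6 - 792 * X ^ 5 + 14352 * X ^ 4 - 73728 * X ^ 3 + 116736 * X ^ 2
      - 73728 * X + 16384 with hP
  have hdeg : P.natDegree = 6 := by rw [hP]; compute_degree!
  have hm : P.Monic := by rw [hP]; monicity!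
  have hP1 : P ≠ 1 := by
    intro h
    simp [h] at hdeg
  refine (hm.irreducible_iff_natDegree').2 ⟨hP1, fun f g hf hg hfg hmem => ?_⟩
  rw [hdeg, Finset.mem_Ioc] at hmem
  have hsum : f.natDegree + g.natDegree = 6 := by
    rw [← hf.natDegree_mul hg, hfg, hdeg]
  have hc (k : ℕ) : ∑ x ∈ Finset.HasAntidiagonal.antidiagonal k, f.coeff x.1 * g.coeff x.2 = P.coeff k := by
    rw [← hfg, coeff_mul]
  have hg0 (k : ℕ) (hk : g.natDegree < k) : g.coeff k = 0 := coeff_eq_zero_of_natDegree_lt hk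
  have hf0 (k : ℕ) (hk : f.natDegree < k) : f.coeff k = 0 := coeff_eq_zero_of_natDegree_lt hk
  have hgl : g.coeff g.natDegree = 1 := hg
  have hfl : f.coeff f.natDegree = 1 := hf
  have h0 := hc 0
  have h1 := hc 1
  have h2 := hc 2
  have h3 := hc 3
  have h4 := hc 4
  have h5 := hc 5
  simp [Finset.Nat.antidiagonal_succ, hP, coeff_X, coeff_X_pow, coeff_ofNat_mul]
    at h0 h1 h2 h3 h4 h5
  obtain hgd | hgd | hgd : g.natDegree = 1 ∨ g.natDegree = 2 ∨ g.natDegree = 3 := by omega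
  · have hfd : f.natDegree = 5 := by omega
    rw [hgd] at hgl
    rw [hfd] at hfl
    simp only [hgl, hfl, hg0 2 (by omega), hg0 3 (by omega), hg0 4 (by omega), hg0 5 (by omega),
      mul_one, one_mul, mul_zero, zero_add]
      at h0 h1 h2 h3 h4 h5
    apply_fun (Int.cast : ℤ → ZMod 7) at h0 h1 h2 h3 h4 h5
    push_cast at h0 h1 h2 h3 h4 h5
    exact no_linear_factor_mod_seven _ _ _ _ _ _ h0 h1 h2 h3 h4 h5
  · have hfd : f.natDegree = 4 := by omega
    rw [hgd] at hgl
    rw [hfd] at hfl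
    simp only [hgl, hfl, hg0 3 (by omega), hg0 4 (by omega), hg0 5 (by omega), hf0 5 (by omega),
      mul_one, one_mul, mul_zero, zero_mul, zero_add, add_zero]
      at h0 h1 h2 h3 h4 h5
    apply_fun (Int.cast : ℤ → ZMod 7) at h0 h1 h2 h3 h4 h5
    push_cast at h0 h1 h2 h3 h4 h5
    exact no_quadratic_factor_mod_seven _ _ _ _ _ _ h0 h1 h2 h3 h4 h5
  · have hfd : f.natDegree = 3 := by omega
    rw [hgd] at hgl
    rw [hfd] at hfl
    simp only [hgl, hfl, hg0 4 (by omega), hg0 5 (by omega), hf0 4 (by omega), hf0 5 (by omega),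
      mul_one, one_mul, mul_zero, zero_mul, zero_add, add_zero]
      at h0 h1 h2 h3 h4 h5
    apply_fun (Int.cast : ℤ → ZMod 5) at h0 h1 h2 h3 h4 h5
    push_cast at h0 h1 h2 h3 h4 h5
    exact no_cubic_factor_mod_five _ _ _ _ _ _ h0 h1 h2 h3 h4 h5

theorem genus_three_matrix_charpoly_irreducible :
    Irreducible
      (((!![500, 248, 232, 112, 80, 32;
            248, 124, 116, 56, 40, 16;
            232, 116, 116, 56, 40, 16;
            112, 56, 56, 28, 20, 8;
            80, 40, 40, 20, 20, 8;
            32, 16, 16, 8, 8, 4] : Matrix (Fin 6) (Fin 6) ℤ)).charpoly.map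
        (Int.castRingHom ℚ)) := by
  have hm := Matrix.charpoly_monic (!![500, 248, 232, 112, 80, 32;
            248, 124, 116, 56, 40, 16;
            232, 116, 116, 56, 40, 16;
            112, 56, 56, 28, 20, 8;
            80, 40, 40, 20, 20, 8;
            32, 16, 16, 8, 8, 4] : Matrix (Fin 6) (Fin 6) ℤ)
  refine (Polynomial.Monic.irreducible_iff_irreducible_map_fraction_map (K := ℚ) hm).1 ?_
  rw [genus_three_matrix_charpoly]
  exact genus_three_polynomial_irreducible
end

section
/- Let λ be a nonzero complex number that is algebraic over ℚ, suppose its minimal polynomial over ℚ has degree 2d with d ≥ 1, and suppose λ⁻¹ is also a root of this minimal polynomial. Then the minimal polynomial of λ + λ⁻¹ over ℚ has degree d. -/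
open Polynomial IntermediateField in
/-- If `b⁻¹` is a conjugate of `b` over `F` and `b` lies in `F⟮b + b⁻¹⟯`, then `b = b⁻¹`: the
embedding of `F⟮b⟯` sending `b` to `b⁻¹` fixes `b + b⁻¹`, hence fixes `b`. -/
theorem eq_inv_of_mem_adjoin_add_inv {F E : Type*} [Field F] [Field E] [Algebra F E] {b : E}
    (hb : IsIntegral F b) (hroot : aeval b⁻¹ (minpoly F b) = 0) (hmem : b ∈ F⟮b + b⁻¹⟯) :
    b = b⁻¹ := by
  obtain ⟨r, s, hrs⟩ := (mem_adjoin_simple_iff F b).1 hmem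
  let σ : F⟮b⟯ →ₐ[F] E := (adjoin.powerBasis hb).lift b⁻¹ (by
    rwa [adjoin.powerBasis_gen, minpoly_gen])
  have hσ : σ (AdjoinSimple.gen F b) = b⁻¹ := by
    simpa only [adjoin.powerBasis_gen] using (adjoin.powerBasis hb).lift_gen b⁻¹ _
  set g := AdjoinSimple.gen F b
  have hgb : F⟮b⟯.val g = b := rfl
  have key : g = aeval (g + g⁻¹) r / aeval (g + g⁻¹) s := by
    apply (show Function.Injective F⟮b⟯.val from F⟮b⟯.val.injective)
    rw [map_div₀, ← aeval_algHom_apply, ← aeval_algHom_apply, map_add, map_inv₀, hgb]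
    exact hrs
  have h := congrArg σ key
  rw [map_div₀, ← aeval_algHom_apply, ← aeval_algHom_apply, map_add, map_inv₀, hσ, inv_inv,
    add_comm b⁻¹ b, ← hrs] at h
  exact h.symm

open Polynomial IntermediateField in
/-- `b` has degree at most two over `F⟮b + b⁻¹⟯`, as a root of the quadratic
`X ^ 2 - (b + b⁻¹) X + 1`. -/
theorem natDegree_minpoly_adjoin_add_inv_le {F E : Type*} [Field F] [Field E] [Algebra F E]
    {b : E} (hb : b ≠ 0) : (minpoly F⟮b + b⁻¹⟯ b).natDegree ≤ 2 := by
  let p : F⟮b + b⁻¹⟯[X] := X ^ 2 - C (AdjoinSimple.gen F (b + b⁻¹)) * X + 1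
  have hdeg : p.natDegree = 2 := by
    simp only [p]; compute_degree!
  have hp : p ≠ 0 := by
    intro h
    simp [h] at hdeg
  refine hdeg ▸ natDegree_le_of_dvd (minpoly.dvd _ _ ?_) hp
  simp only [p, map_add, map_sub, map_mul, map_pow, aeval_X, aeval_C, map_one,
    AdjoinSimple.algebraMap_gen]
  field_simp
  ring

open IntermediateField in
theorem natDegree_minpoly_eq_mul_of_mem_adjoin {F E : Type*} [Field F] [Field E] [Algebra F E]
    {a b : E} (hb : IsIntegral F b) (ha : a ∈ F⟮b⟯) :
    (minpoly F b).natDegree = (minpoly F a).natDegree * (minpoly F⟮a⟯ b).natDegree := by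
  have : FiniteDimensional F F⟮b⟯ := adjoin.finiteDimensional hb
  have haint : IsIntegral F a :=
    (isIntegral_algebraMap_iff (algebraMap F⟮b⟯ E).injective).2
      (IsIntegral.of_finite F (⟨a, ha⟩ : F⟮b⟯))
  have heq : F⟮a⟯⟮b⟯.restrictScalars F = F⟮b⟯ := by
    rw [adjoin_simple_adjoin_simple]
    apply le_antisymm
    · rw [adjoin_le_iff]
      rintro x (rfl | rfl)
      · exact ha
      · exact mem_adjoin_simple_self F _
    · exact adjoin.mono F _ _ (by simp)
  rw [← adjoin.finrank hb, ← adjoin.finrank haint, ← adjoin.finrank hb.tower_top, ← heq]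
  exact (Module.finrank_mul_finrank F F⟮a⟯ F⟮a⟯⟮b⟯).symm

open IntermediateField in
theorem trace_field_degree_of_reciprocal
    (lam : ℂ) (hne : lam ≠ 0) (halg : IsAlgebraic ℚ lam)
    (d : ℕ) (hd : 1 ≤ d)
    (hdeg : (minpoly ℚ lam).natDegree = 2 * d)
    (hrecip : Polynomial.aeval lam⁻¹ (minpoly ℚ lam) = 0) :
    (minpoly ℚ (lam + lam⁻¹)).natDegree = d := by
  have hint : IsIntegral ℚ lam := halg.isIntegral
  have hgen : lam ∈ ℚ⟮lam⟯ := mem_adjoin_simple_self ℚ lam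
  have hmul := natDegree_minpoly_eq_mul_of_mem_adjoin hint (add_mem hgen (inv_mem hgen))
  have hle := natDegree_minpoly_adjoin_add_inv_le (F := ℚ) hne
  have hpos := minpoly.natDegree_pos (hint.tower_top (A := ℚ⟮lam + lam⁻¹⟯))
  have hone : (minpoly ℚ⟮lam + lam⁻¹⟯ lam).natDegree ≠ 1 := by
    intro h
    obtain ⟨x, hx⟩ := minpoly.natDegree_eq_one_iff.1 h
    have hmem : lam ∈ ℚ⟮lam + lam⁻¹⟯ := Set.mem_of_eq_of_mem hx.symm x.2
    have hinv : lam = lam⁻¹ := eq_inv_of_mem_adjoin_add_inv hint hrecip hmem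
    have hrat : lam ∈ (algebraMap ℚ ℂ).range := by
      rcases (mul_self_eq_one_iff (a := lam)).1 ((eq_mul_inv_iff_mul_eq₀ hne).1 (by rwa [one_mul])) with h | h
      · exact ⟨1, by simp [h]⟩
      · exact ⟨-1, by simp [h]⟩
    have := minpoly.natDegree_eq_one_iff.2 hrat
    omega
  have htwo : (minpoly ℚ⟮lam + lam⁻¹⟯ lam).natDegree = 2 := by omega
  rw [htwo] at hmul
  omega
end

section
/- Let R be a commutative ring and let X be an m×n matrix over R with m ≥ n. Let Ω be the (m+n)×(m+n) block matrix ((0, X), (Xᵀ, 0)), where Xᵀ denotes the transpose of X. Then the characteristic polynomial of Ω equals t^{m−n} · χ_{XᵀX}(t²), i.e. t^{m−n} times the composition of the characteristic polynomial of the n×n matrix XᵀX with t². -/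
open Polynomial in
theorem Matrix.charpoly_comp {ι R : Type*} [CommRing R] [Fintype ι] [DecidableEq ι]
    (A : Matrix ι ι R) (p : R[X]) :
    A.charpoly.comp p = (Matrix.scalar ι p - A.map C).det := by
  rw [Matrix.charpoly, ← coe_compRingHom_apply, RingHom.map_det]
  congr 1
  ext i j : 1
  rcases eq_or_ne i j with rfl | h
  · simp
  · simp [h]

open Polynomial in
theorem Matrix.X_pow_card_mul_charpoly_fromBlocks_zero_diag {ι κ R : Type*} [CommRing R]
    [Fintype ι] [DecidableEq ι] [Fintype κ] [DecidableEq κ]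
    (A : Matrix ι κ R) (B : Matrix κ ι R) :
    X ^ Fintype.card κ * (Matrix.fromBlocks 0 A B 0).charpoly =
      X ^ Fintype.card ι * (B * A).charpoly.comp (X ^ 2) := by
  have h : (Matrix.fromBlocks 0 A B 0).charmatrix *
        Matrix.fromBlocks 1 (A.map C) 0 (Matrix.scalar κ (X : R[X])) =
      Matrix.fromBlocks (Matrix.scalar ι X) 0 (-B.map C)
        (Matrix.scalar κ (X ^ 2) - (B * A).map C) := by
    rw [Matrix.charmatrix_fromBlocks, Matrix.fromBlocks_multiply]
    congr 1
    · simp [Matrix.charmatrix]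
    · ext i j : 1
      simp [Matrix.charmatrix, X_mul_C]
    · simp
    · rw [Matrix.map_mul]
      simp [Matrix.charmatrix, sq, sub_eq_neg_add]
  have h_det := congrArg Matrix.det h
  rw [Matrix.det_mul, Matrix.det_fromBlocks_zero₂₁, Matrix.det_fromBlocks_zero₁₂,
    ← Matrix.charpoly_comp] at h_det
  simpa [Matrix.charpoly, mul_comm] using h_det

open Matrix in
theorem charpoly_bipartite_block_matrix
    (R : Type*) [CommRing R] (m n : ℕ) (hmn : n ≤ m)
    (X : Matrix (Fin m) (Fin n) R) :
    (Matrix.fromBlocks 0 X Xᵀ 0).charpoly =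
      Polynomial.X ^ (m - n) * ((Xᵀ * X).charpoly.comp (Polynomial.X ^ 2)) := by
  rw [← (Polynomial.isRegular_X_pow n).left.eq_iff, ← mul_assoc, ← pow_add,
    Nat.add_sub_cancel' hmn]
  simpa using Matrix.X_pow_card_mul_charpoly_fromBlocks_zero_diag X Xᵀ
end
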